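/- arXiv:2309.15746 — 3 statements merged into one kernel-verified Lean document; each statement's English description precedes it below -/
import Mathlib

section
/- Let (X, Σ) be a measurable space, let P and Q be probability measures on (X, Σ) with Q absolutely continuous with respect to P, and let f be a measurable representative of the Radon–Nikodym derivative dQ/dP. Define the sequence of functions t_d : X → ℝ recursively by t_0(x) = 0 and t_{d+1}(x) = t_d(x) + min{ f(x) − t_d(x), 1 − ∫ t_d dP }. Then for every d ≥ 0, for P-almost every x ∈ X we have 0 ≤ t_d(x) ≤ t_{d+1}(x) ≤ f(x); consequently, for every measurable set S ⊆ X and every d, ∫_S t_d dP ≤ Q(S). -/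
open MeasureTheory Filter

/-- Adding the smaller of the remaining density and the remaining mass preserves the
almost-everywhere bounds by the target density. -/
theorem ae_bounds_of_greedy_rec {X : Type*} [MeasurableSpace X] {P : Measure X}
    {f : X → ℝ} (hf_int : Integrable f P) (hf_nonneg : 0 ≤ᵐ[P] f)
    (hf_mass : ∫ x, f x ∂P ≤ 1) {t : ℕ → X → ℝ} (ht0 : ∀ x, t 0 x = 0)
    (htrec : ∀ d x, t (d + 1) x = t d x + min (f x - t d x) (1 - ∫ y, t d y ∂P)) (d : ℕ) :
    ∀ᵐ x ∂P, 0 ≤ t d x ∧ t d x ≤ t (d + 1) x ∧ t (d + 1) x ≤ f x := by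
  have step : ∀ d, (∀ᵐ x ∂P, 0 ≤ t d x ∧ t d x ≤ f x) →
      ∀ᵐ x ∂P, 0 ≤ t d x ∧ t d x ≤ t (d + 1) x ∧ t (d + 1) x ≤ f x := by
    intro d hd
    have hmass : ∫ y, t d y ∂P ≤ 1 :=
      (integral_mono_of_nonneg (hd.mono fun _ h => h.1) hf_int (hd.mono fun _ h => h.2)).trans
        hf_mass
    filter_upwards [hd] with x hx
    rw [htrec]
    have hmin : 0 ≤ min (f x - t d x) (1 - ∫ y, t d y ∂P) :=
      le_min (sub_nonneg.2 hx.2) (sub_nonneg.2 hmass)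
    have hle := min_le_left (f x - t d x) (1 - ∫ y, t d y ∂P)
    exact ⟨hx.1, by linarith, by linarith⟩
  induction d with
  | zero =>
    refine step 0 ?_
    filter_upwards [hf_nonneg] with x hx
    simpa [ht0] using hx
  | succ d ih => exact step (d + 1) (ih.mono fun x hx => ⟨hx.1.trans hx.2.1, hx.2.2⟩)

theorem grc_global_rejection_mass_monotone
    {X : Type*} [MeasurableSpace X]
    (P Q : Measure X) [IsProbabilityMeasure P] [IsProbabilityMeasure Q]
    (hQP : Q ≪ P)
    (f : X → ℝ) (hf_meas : Measurable f)
    (hf : f =ᵐ[P] fun x => (Q.rnDeriv P x).toReal)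
    (t : ℕ → X → ℝ)
    (ht0 : ∀ x, t 0 x = 0)
    (htrec : ∀ d x, t (d + 1) x = t d x + min (f x - t d x) (1 - ∫ y, t d y ∂P)) :
    (∀ d : ℕ, ∀ᵐ x ∂P, 0 ≤ t d x ∧ t d x ≤ t (d + 1) x ∧ t (d + 1) x ≤ f x) ∧
    (∀ S : Set X, MeasurableSet S → ∀ d : ℕ, ∫ x in S, t d x ∂P ≤ (Q S).toReal) := by
  have hf_int : Integrable f P := Measure.integrable_toReal_rnDeriv.congr hf.symm
  have hf_nonneg : 0 ≤ᵐ[P] f := hf.mono fun x hx => hx ▸ ENNReal.toReal_nonneg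
  have hf_set : ∀ S : Set X, ∫ x in S, f x ∂P = (Q S).toReal := fun S =>
    (integral_congr_ae (ae_restrict_of_ae hf)).trans (Measure.setIntegral_toReal_rnDeriv hQP S)
  have hf_mass : ∫ x, f x ∂P ≤ 1 := by
    rw [← setIntegral_univ, hf_set]
    simp
  have key : ∀ d : ℕ, ∀ᵐ x ∂P, 0 ≤ t d x ∧ t d x ≤ t (d + 1) x ∧ t (d + 1) x ≤ f x := fun d =>
    ae_bounds_of_greedy_rec hf_int hf_nonneg hf_mass ht0 htrec d
  refine ⟨key, fun S _ d => ?_⟩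
  rw [← hf_set S]
  exact integral_mono_of_nonneg (ae_restrict_of_ae ((key d).mono fun _ h => h.1))
    hf_int.integrableOn (ae_restrict_of_ae ((key d).mono fun _ h => h.2.1.trans h.2.2))
end

section
/- Let (X, Σ) be a measurable space, let P and Q be probability measures on (X, Σ) with Q absolutely continuous with respect to P, and let f be a measurable representative of the Radon–Nikodym derivative dQ/dP. Define the sequence of functions t_d : X → ℝ recursively by t_0(x) = 0 and t_{d+1}(x) = t_d(x) + min{ f(x) − t_d(x), 1 − ∫ t_d dP }. Then: (a) ∫ t_d dP → 1 as d → ∞ (the algorithm terminates with probability 1); (b) ∫ |f − t_d| dP → 0 as d → ∞, and hence for every measurable set S ⊆ X, ∫_S t_d dP → Q(S) (the returned sample has law exactly Q); (c) t_d(x) → f(x) for P-almost every x. -/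
open MeasureTheory Filter

theorem grc_global_correctness
    {X : Type*} [MeasurableSpace X]
    (P Q : Measure X) [IsProbabilityMeasure P] [IsProbabilityMeasure Q]
    (hQP : Q ≪ P)
    (f : X → ℝ) (hf_meas : Measurable f)
    (hf : f =ᵐ[P] fun x => (Q.rnDeriv P x).toReal)
    (t : ℕ → X → ℝ)
    (ht0 : ∀ x, t 0 x = 0)
    (htrec : ∀ d x, t (d + 1) x = t d x + min (f x - t d x) (1 - ∫ y, t d y ∂P)) :
    Tendsto (fun d => ∫ x, t d x ∂P) atTop (nhds 1) ∧
    Tendsto (fun d => ∫ x, |f x - t d x| ∂P) atTop (nhds 0) ∧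
    (∀ S : Set X, MeasurableSet S →
      Tendsto (fun d => ∫ x in S, t d x ∂P) atTop (nhds (Q S).toReal)) ∧
    (∀ᵐ x ∂P, Tendsto (fun d => t d x) atTop (nhds (f x))) := by
  have hf_int : Integrable f P := Measure.integrable_toReal_rnDeriv.congr hf.symm
  have hf_set (S : Set X) : ∫ x in S, f x ∂P = (Q S).toReal := by
    rw [integral_congr_ae (ae_restrict_of_ae hf)]
    exact Measure.setIntegral_toReal_rnDeriv hQP S
  have hf_one : ∫ x, f x ∂P = 1 := by simpa using hf_set Set.univ
  have ht_int (d : ℕ) : Integrable (t d) P := by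
    induction d with
    | zero => simp [funext ht0]
    | succ d ih =>
      rw [funext (htrec d)]
      exact ih.add ((hf_int.sub ih).inf (integrable_const _))
  have hle : ∀ᵐ x ∂P, ∀ d, t d x ≤ f x := by
    filter_upwards [hf] with x hx d
    cases d with
    | zero => rw [ht0, hx]; exact ENNReal.toReal_nonneg
    | succ d => linarith [htrec d x, min_le_left (f x - t d x) (1 - ∫ y, t d y ∂P)]
  have ht_le_one (d : ℕ) : ∫ x, t d x ∂P ≤ 1 :=
    hf_one ▸ integral_mono_ae (ht_int d) hf_int (hle.mono fun x hx => hx d)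
  have hmono : ∀ᵐ x ∂P, Monotone fun d => t d x := by
    filter_upwards [hle] with x hx
    refine monotone_nat_of_le_succ fun d => ?_
    rw [htrec]
    exact le_add_of_nonneg_right
      (le_min (sub_nonneg.2 (hx d)) (sub_nonneg.2 (ht_le_one d)))
  have hmono_int : Monotone fun d => ∫ x, t d x ∂P := fun m n hmn =>
    integral_mono_ae (ht_int m) (ht_int n) (hmono.mono fun x hx => hx hmn)
  have hbdd : BddAbove (Set.range fun d => ∫ x, t d x ∂P) :=
    ⟨1, Set.forall_mem_range.2 ht_le_one⟩
  have hlim := tendsto_atTop_ciSup hmono_int hbdd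
  set m := ⨆ d, ∫ x, t d x ∂P
  have hm : m = 1 := by
    refine le_antisymm (ciSup_le ht_le_one) ?_
    by_contra! hlt
    have hc : 0 < 1 - m := sub_pos.2 hlt
    -- If mass were left over, every step would advance by at least `1 - m` until reaching `f`.
    have hlow (x : X) (d : ℕ) : min (f x) (d * (1 - m)) ≤ t d x := by
      induction d with
      | zero => simp [ht0]
      | succ d ih =>
        have hd : ∫ x, t d x ∂P ≤ m := le_ciSup hbdd d
        rw [htrec]
        push_cast
        grind
    have htend : ∀ᵐ x ∂P, Tendsto (fun d => t d x) atTop (nhds (f x)) := by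
      filter_upwards [hle] with x hx
      obtain ⟨N, hN⟩ := exists_nat_ge (f x / (1 - m))
      refine tendsto_const_nhds.congr' ?_
      filter_upwards [eventually_ge_atTop N] with d hd
      have hfd : f x ≤ d * (1 - m) :=
        (div_le_iff₀ hc).1 (hN.trans (Nat.cast_le.2 hd))
      exact le_antisymm (by simpa [hfd] using hlow x d) (hx d)
    have := integral_tendsto_of_tendsto_of_monotone ht_int hf_int hmono htend
    rw [hf_one] at this
    exact hlt.ne (tendsto_nhds_unique hlim this)
  rw [hm] at hlim
  have hL1 : Tendsto (fun d => ∫ x, |f x - t d x| ∂P) atTop (nhds 0) := by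
    have h (d : ℕ) : ∫ x, |f x - t d x| ∂P = 1 - ∫ x, t d x ∂P := by
      rw [← hf_one, ← integral_sub hf_int (ht_int d)]
      exact integral_congr_ae (hle.mono fun x hx => abs_of_nonneg (sub_nonneg.2 (hx d)))
    simpa [h] using hlim.const_sub 1
  refine ⟨hlim, hL1, fun S _ => ?_, ?_⟩
  · rw [← hf_set S, tendsto_iff_dist_tendsto_zero]
    refine squeeze_zero (fun _ => dist_nonneg) (fun d => ?_) hL1
    rw [dist_comm, Real.dist_eq, ← integral_sub hf_int.integrableOn (ht_int d).integrableOn]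
    exact abs_integral_le_integral_abs.trans
      (setIntegral_le_integral (hf_int.sub (ht_int d)).abs (ae_of_all _ fun _ => abs_nonneg _))
  · exact tendsto_of_integral_tendsto_of_monotone ht_int hf_int (hf_one.symm ▸ hlim) hmono hle
end

section
/- Let P be a probability measure on ℝ whose cumulative distribution function F (defined by F(x) = P((−∞, x])) is continuous, and let a < b be real numbers with P((a, b)) > 0. Then ∫_{(a,b)} max(F(x) − F(a), F(b) − F(x)) dP(x) = (3/4)(F(b) − F(a))². In particular, if X is distributed according to the restriction of P to (a, b) normalized to a probability measure, then E[max(P((a, X)), P((X, b)))] ≤ (3/4) P((a, b)). -/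
open MeasureTheory

section ContinuousCDF

variable {P : Measure ℝ} [IsProbabilityMeasure P] {F : ℝ → ℝ}

theorem measure_Ioc_eq_of_cdf (hF : ∀ x, F x = (P (Set.Iic x)).toReal) (u v : ℝ) :
    P (Set.Ioc u v) = ENNReal.ofReal (F v - F u) := by
  have hcdf : ∀ x, F x = ProbabilityTheory.cdf P x := fun x ↦ by
    rw [hF, ProbabilityTheory.cdf_eq_real, Measure.real]
  rw [hcdf, hcdf, ← StieltjesFunction.measure_Ioc, ProbabilityTheory.measure_cdf]

theorem measure_Ioo_eq_of_continuous_cdf (hF : ∀ x, F x = (P (Set.Iic x)).toReal)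
    (hFcont : Continuous F) (u v : ℝ) :
    P (Set.Ioo u v) = ENNReal.ofReal (F v - F u) := by
  have hcdf : F = ProbabilityTheory.cdf P := funext fun x ↦ by
    rw [hF, ProbabilityTheory.cdf_eq_real, Measure.real]
  have hleft : Function.leftLim (ProbabilityTheory.cdf P) v = ProbabilityTheory.cdf P v :=
    (hcdf ▸ hFcont.continuousAt (x := v)).continuousWithinAt.leftLim_eq
  rw [hcdf, ← hleft, ← StieltjesFunction.measure_Ioo, ProbabilityTheory.measure_cdf]

theorem monotone_of_cdf (hF : ∀ x, F x = (P (Set.Iic x)).toReal) : Monotone F := by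
  intro x y hxy
  rw [hF, hF]
  exact ENNReal.toReal_mono (measure_ne_top _ _) (measure_mono (Set.Iic_subset_Iic.2 hxy))

/-- The probability integral transform: a continuous distribution function pushes the restriction
of the measure to an interval forward to Lebesgue measure on the image interval. -/
theorem map_restrict_Ioo_of_continuous_cdf (hF : ∀ x, F x = (P (Set.Iic x)).toReal)
    (hFcont : Continuous F) {a b : ℝ} (hab : a < b) :
    (P.restrict (Set.Ioo a b)).map F = volume.restrict (Set.Ioc (F a) (F b)) := by
  have hmono := monotone_of_cdf hF
  refine Measure.ext_of_Iic _ _ fun t ↦ ?_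
  rw [Measure.map_apply hFcont.measurable measurableSet_Iic,
    Measure.restrict_apply (hFcont.measurable measurableSet_Iic),
    Measure.restrict_apply measurableSet_Iic]
  rcases lt_or_ge t (F a) with hta | hta
  · have h₁ : F ⁻¹' Set.Iic t ∩ Set.Ioo a b = ∅ := by
      refine Set.eq_empty_of_forall_notMem fun x ⟨hx, hxab⟩ ↦ ?_
      exact (hta.trans_le (hmono hxab.1.le)).not_ge hx
    have h₂ : Set.Iic t ∩ Set.Ioc (F a) (F b) = ∅ := by
      refine Set.eq_empty_of_forall_notMem fun y ⟨hy, hyab⟩ ↦ ?_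
      exact (hta.trans hyab.1).not_ge hy
    rw [h₁, h₂, measure_empty, measure_empty]
  rcases le_or_gt (F b) t with htb | htb
  · have h₁ : Set.Ioo a b ⊆ F ⁻¹' Set.Iic t := fun x hx ↦ (hmono hx.2.le).trans htb
    have h₂ : Set.Ioc (F a) (F b) ⊆ Set.Iic t := fun y hy ↦ hy.2.trans htb
    rw [Set.inter_eq_right.2 h₁, Set.inter_eq_right.2 h₂, Real.volume_Ioc,
      measure_Ioo_eq_of_continuous_cdf hF hFcont]
  · have hne : (Set.Icc a b ∩ F ⁻¹' {t}).Nonempty := by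
      obtain ⟨c, hc, hct⟩ := intermediate_value_Icc hab.le hFcont.continuousOn ⟨hta, htb.le⟩
      exact ⟨c, hc, hct⟩
    obtain ⟨c, ⟨hcab, hct⟩, hmax⟩ :=
      (isCompact_Icc.inter_right (isClosed_singleton.preimage hFcont)).exists_isGreatest hne
    have hct : F c = t := hct
    have hcb : c < b := hcab.2.lt_of_ne fun h ↦ by subst h; exact htb.ne hct.symm
    have h₁ : F ⁻¹' Set.Iic t ∩ Set.Ioo a b = Set.Ioc a c := by
      ext x
      refine ⟨fun ⟨hx, hxab⟩ ↦ ⟨hxab.1, ?_⟩,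
        fun hx ↦ ⟨(hmono hx.2).trans hct.le, hx.1, hx.2.trans_lt hcb⟩⟩
      by_contra! hcx
      exact hcx.not_ge (hmax ⟨⟨hxab.1.le, hxab.2.le⟩,
        le_antisymm hx (hct.symm.trans_le (hmono hcx.le))⟩)
    have h₂ : Set.Iic t ∩ Set.Ioc (F a) (F b) = Set.Ioc (F a) t := by
      ext y
      exact ⟨fun ⟨hy, hyab⟩ ↦ ⟨hyab.1, hy⟩, fun hy ↦ ⟨hy.2, hy.1, hy.2.trans htb.le⟩⟩
    rw [h₁, h₂, Real.volume_Ioc, measure_Ioc_eq_of_cdf hF, hct]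

end ContinuousCDF

theorem intervalIntegral_max_sub_sub {A B : ℝ} (hAB : A ≤ B) :
    ∫ y in A..B, max (y - A) (B - y) = 3 / 4 * (B - A) ^ 2 := by
  have hcont : Continuous fun y : ℝ ↦ max (y - A) (B - y) := by fun_prop
  rw [← intervalIntegral.integral_add_adjacent_intervals
    (hcont.intervalIntegrable A ((A + B) / 2)) (hcont.intervalIntegrable ((A + B) / 2) B)]
  have h₁ : ∫ y in A..((A + B) / 2), max (y - A) (B - y) = ∫ y in A..((A + B) / 2), (B - y) := by
    refine intervalIntegral.integral_congr fun y hy ↦ max_eq_right ?_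
    rw [Set.uIcc_of_le (by linarith)] at hy
    linarith [hy.2]
  have h₂ : ∫ y in ((A + B) / 2)..B, max (y - A) (B - y) = ∫ y in ((A + B) / 2)..B, (y - A) := by
    refine intervalIntegral.integral_congr fun y hy ↦ max_eq_left ?_
    rw [Set.uIcc_of_le (by linarith)] at hy
    linarith [hy.1]
  rw [h₁, h₂, intervalIntegral.integral_sub (by simp) (by simp),
    intervalIntegral.integral_sub (by simp) (by simp)]
  simp only [intervalIntegral.integral_const, integral_id, smul_eq_mul]
  ring

theorem sample_splitting_contraction
    (P : Measure ℝ) [IsProbabilityMeasure P]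
    (F : ℝ → ℝ) (hF : ∀ x, F x = (P (Set.Iic x)).toReal) (hFcont : Continuous F)
    (a b : ℝ) (hab : a < b) (hpos : 0 < P (Set.Ioo a b)) :
    (∫ x in Set.Ioo a b, max (F x - F a) (F b - F x) ∂P) =
      3 / 4 * (F b - F a) ^ 2 ∧
    (∫ x, max (P (Set.Ioo a x)).toReal (P (Set.Ioo x b)).toReal
        ∂((P (Set.Ioo a b))⁻¹ • P.restrict (Set.Ioo a b))) ≤
      3 / 4 * (P (Set.Ioo a b)).toReal := by
  have hmono := monotone_of_cdf hF
  have hIoo : ∀ {u v : ℝ}, u ≤ v → (P (Set.Ioo u v)).toReal = F v - F u := fun huv ↦ by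
    rw [measure_Ioo_eq_of_continuous_cdf hF hFcont,
      ENNReal.toReal_ofReal (sub_nonneg.2 (hmono huv))]
  have hint : (∫ x in Set.Ioo a b, max (F x - F a) (F b - F x) ∂P) =
      3 / 4 * (F b - F a) ^ 2 := by
    have hcont : Continuous fun y : ℝ ↦ max (y - F a) (F b - y) := by fun_prop
    rw [← integral_map (f := fun y ↦ max (y - F a) (F b - y)) hFcont.aemeasurable
      hcont.aestronglyMeasurable, map_restrict_Ioo_of_continuous_cdf hF hFcont hab,
      ← intervalIntegral.integral_of_le (hmono hab.le),
      intervalIntegral_max_sub_sub (hmono hab.le)]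
  refine ⟨hint, le_of_eq ?_⟩
  have hne : F b - F a ≠ 0 :=
    hIoo hab.le ▸ (ENNReal.toReal_pos hpos.ne' (measure_ne_top _ _)).ne'
  have hcongr : (∫ x in Set.Ioo a b, max (P (Set.Ioo a x)).toReal (P (Set.Ioo x b)).toReal ∂P) =
      ∫ x in Set.Ioo a b, max (F x - F a) (F b - F x) ∂P :=
    setIntegral_congr_fun measurableSet_Ioo fun x hx ↦ by
      simp only [hIoo hx.1.le, hIoo hx.2.le]
  rw [integral_smul_measure, hcongr, hint, ENNReal.toReal_inv, hIoo hab.le, smul_eq_mul]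
  field_simp
end
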